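/- arXiv:0902.2235 — 2 statements merged into one kernel-verified Lean document; each statement's English description precedes it below -/
import Mathlib

section
/- Strong isometries map atomic codewords into atomic codewords: if φ : C → C̄ is a strong isometry between convolutional codes C, C̄ ⊆ F[z]^n and v ∈ C is atomic, then φ(v) ∈ C̄ is atomic. -/
open Matrix Polynomial

variable {F : Type*} [Field F]

/-- The weight of a polynomial row vector: the total number of nonzero
coefficients occurring in its entries. -/
def wtP {n : ℕ} (v : Fin n → Polynomial F) : ℕ := ∑ i, (v i).support.card

/-- The degree of a polynomial row vector: the maximal degree of its entries. -/
def degP {n : ℕ} (v : Fin n → Polynomial F) : ℕ := Finset.univ.sup fun i => (v i).natDegree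

/-- The delay of a polynomial row vector: the least `t` such that the `t`-th
coefficient vector is nonzero. -/
noncomputable def delP {n : ℕ} (v : Fin n → Polynomial F) : ℕ :=
  sInf {t : ℕ | ∃ i, (v i).coeff t ≠ 0}

/-- A polynomial matrix is basic if its evaluation at every point of the algebraic
closure has full row rank. -/
def IsBasic {k n : ℕ} (G : Matrix (Fin k) (Fin n) (Polynomial F)) : Prop :=
  ∀ lam : AlgebraicClosure F, (G.map fun p => (Polynomial.aeval lam) p).rank = k

/-- The set of codewords generated by the encoder `G`. -/
def codeOf {k n : ℕ} (G : Matrix (Fin k) (Fin n) (Polynomial F)) :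
    Set (Fin n → Polynomial F) :=
  Set.range fun u : Fin k → Polynomial F => u ᵥ* G

/-- A convolutional code of length `n`: a submodule of `F[z]^n` generated by some
basic matrix. -/
def IsConvCode {n : ℕ} (C : Submodule (Polynomial F) (Fin n → Polynomial F)) : Prop :=
  ∃ (k : ℕ) (G : Matrix (Fin k) (Fin n) (Polynomial F)),
    IsBasic G ∧ (C : Set (Fin n → Polynomial F)) = codeOf G

/-- Atomicity of a codeword `v` of a code (given as a set) `S`. -/
def IsAtomicCW {n : ℕ} (S : Set (Fin n → Polynomial F)) (v : Fin n → Polynomial F) : Prop :=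
  v ≠ 0 ∧ (∃ i, (v i).coeff 0 ≠ 0) ∧
    ∀ (L : ℕ) (vh vt : Fin n → Polynomial F), vh ∈ S → vt ∈ S → vh ≠ 0 → vt ≠ 0 →
      degP vh ≤ L → (∀ i, ∀ t ≤ L, (vt i).coeff t = 0) → v ≠ vh + vt


/-- Left multiplication by the evaluation of a basic matrix is injective. -/
theorem IsBasic.vecMul_injective {k n : ℕ} {G : Matrix (Fin k) (Fin n) (Polynomial F)}
    (hG : IsBasic G) (lam : AlgebraicClosure F) :
    Function.Injective (G.map fun p => (Polynomial.aeval lam) p).vecMul := by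
  rw [Matrix.vecMul_injective_iff, linearIndependent_iff_card_eq_finrank_span,
    Set.finrank, ← Matrix.rank_eq_finrank_span_row, hG lam, Fintype.card_fin]

/-- A convolutional code is saturated with respect to multiplication by `X`. -/
theorem IsConvCode.mem_of_X_smul_mem {n : ℕ}
    {C : Submodule (Polynomial F) (Fin n → Polynomial F)} (hC : IsConvCode C)
    {w : Fin n → Polynomial F} (hw : (X : Polynomial F) • w ∈ C) : w ∈ C := by
  obtain ⟨k, G, hG, hCG⟩ := hC
  rw [← SetLike.mem_coe, hCG] at hw ⊢
  obtain ⟨u, hu⟩ := hw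
  have hu_zero : (fun i => aeval (0 : AlgebraicClosure F) (u i)) = 0 := by
    apply hG.vecMul_injective 0
    funext j
    have h := congrArg (aeval (0 : AlgebraicClosure F)) (congrFun hu j)
    simpa [Matrix.vecMul, dotProduct] using h
  have hdvd : ∀ i, X ∣ u i := fun i => by
    have h := congrFun hu_zero i
    rw [X_dvd_iff]
    simpa [aeval_def, eval₂_at_zero] using h
  choose u' hu' using hdvd
  refine ⟨u', smul_right_injective _ (X_ne_zero (R := F)) ?_⟩
  simp only
  rw [← hu, ← Matrix.smul_vecMul]
  congr 1
  funext i
  simp [hu' i]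

/-- A convolutional code is saturated with respect to multiplication by powers of `X`. -/
theorem IsConvCode.mem_of_X_pow_smul_mem {n : ℕ}
    {C : Submodule (Polynomial F) (Fin n → Polynomial F)} (hC : IsConvCode C) (m : ℕ)
    {w : Fin n → Polynomial F} (hw : (X ^ m : Polynomial F) • w ∈ C) : w ∈ C := by
  induction m with
  | zero => simpa using hw
  | succ m ih =>
    rw [pow_succ', mul_smul] at hw
    exact ih (hC.mem_of_X_smul_mem hw)

/-- A codeword whose first `m` coefficient vectors vanish is `X ^ m` times a codeword. -/
theorem IsConvCode.exists_eq_X_pow_smul {n : ℕ}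
    {C : Submodule (Polynomial F) (Fin n → Polynomial F)} (hC : IsConvCode C) (m : ℕ) (v : C)
    (hv : ∀ i, ∀ t < m, ((v : Fin n → Polynomial F) i).coeff t = 0) :
    ∃ w : C, v = (X ^ m : Polynomial F) • w := by
  choose w hw using fun i => X_pow_dvd_iff.mpr (hv i)
  have hvw : (v : Fin n → Polynomial F) = (X ^ m : Polynomial F) • w := by
    funext i
    simp [hw i]
  exact ⟨⟨w, hC.mem_of_X_pow_smul_mem m (hvw ▸ v.2)⟩, Subtype.ext hvw⟩

/-- Strong isometries map atomic codewords into atomic codewords. -/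
theorem stmt7 {F : Type*} [Field F] [Fintype F] {n : ℕ}
    (C Cbar : Submodule (Polynomial F) (Fin n → Polynomial F))
    (hC : IsConvCode C) (hCbar : IsConvCode Cbar)
    (φ : C ≃ₗ[Polynomial F] Cbar)
    (hwt : ∀ v : C, wtP ((φ v : Fin n → Polynomial F)) = wtP (v : Fin n → Polynomial F))
    (hdeg : ∀ v : C, (v : Fin n → Polynomial F) ≠ 0 →
      degP ((φ v : Fin n → Polynomial F)) = degP (v : Fin n → Polynomial F))
    (v : C) (hv : IsAtomicCW (C : Set (Fin n → Polynomial F)) (v : Fin n → Polynomial F)) :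
    IsAtomicCW (Cbar : Set (Fin n → Polynomial F)) ((φ v : Fin n → Polynomial F)) := by
  obtain ⟨hv_ne, ⟨i, hi⟩, hv_atom⟩ := hv
  refine ⟨?_, ?_, ?_⟩
  · simpa using hv_ne
  · by_contra! h
    obtain ⟨w, hw⟩ := hCbar.exists_eq_X_pow_smul 1 (φ v) fun i t ht => by
      rw [Nat.lt_one_iff.mp ht]
      exact h i
    have hvw : v = (X ^ 1 : Polynomial F) • φ.symm w := by
      rw [← map_smul, ← hw, φ.symm_apply_apply]
    apply hi
    rw [hvw]
    simp
  · intro L vh vt hvh hvt hvh_ne hvt_ne hdeg_vh hvt_coeff heq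
    obtain ⟨w, hw⟩ := hCbar.exists_eq_X_pow_smul (L + 1) ⟨vt, hvt⟩ fun i t ht =>
      hvt_coeff i t (Nat.lt_succ_iff.mp ht)
    have hvh_symm_ne : ((φ.symm ⟨vh, hvh⟩ : C) : Fin n → Polynomial F) ≠ 0 := by
      simpa using hvh_ne
    refine hv_atom L (φ.symm ⟨vh, hvh⟩) (φ.symm ⟨vt, hvt⟩) (φ.symm ⟨vh, hvh⟩).2
      (φ.symm ⟨vt, hvt⟩).2 hvh_symm_ne (by simpa using hvt_ne) ?_ ?_ ?_
    · rw [← hdeg _ hvh_symm_ne, φ.apply_symm_apply]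
      exact hdeg_vh
    · intro i t ht
      rw [hw, map_smul]
      simp [coeff_X_pow_mul', Nat.not_le.mpr (Nat.lt_succ_of_le ht)]
    · have hsum : φ v = ⟨vh, hvh⟩ + ⟨vt, hvt⟩ := Subtype.ext heq
      rw [← Submodule.coe_add, ← map_add, ← hsum, φ.symm_apply_apply]
end

section
/- Let G, Ḡ ∈ F[z]^{k×n} be basic and reduced matrices which are z-monomially equivalent and have the same row degrees (the i-th row of G and the i-th row of Ḡ have equal degree for every i). Then G and Ḡ are strongly isometric, i.e. wt(uG) = wt(uḠ) for all u ∈ F[z]^k and deg(uG) = deg(uḠ) for all nonzero u ∈ F[z]^k. -/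
open Matrix Polynomial

variable {F : Type*} [Field F]

/-- A `z`-monomial matrix over the rational function field `F(z)`:
permutation times `diag (α_i z^{μ_i})` with `α_i ∈ F*`, `μ_i ∈ ℤ`. -/
def IsZMonomial {n : ℕ} (M : Matrix (Fin n) (Fin n) (RatFunc F)) : Prop :=
  ∃ (σ : Equiv.Perm (Fin n)) (α : Fin n → Fˣ) (μ : Fin n → ℤ),
    ∀ i j, M i j =
      if σ i = j then algebraMap F (RatFunc F) (α j) * (RatFunc.X : RatFunc F) ^ (μ j) else 0

/-- The `i`-th row degree of a polynomial matrix. -/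
def rowDeg {k n : ℕ} (G : Matrix (Fin k) (Fin n) (Polynomial F)) (i : Fin k) : ℕ :=
  Finset.univ.sup fun j => (G i j).natDegree

/-- The (internal) degree of a polynomial matrix: the maximal degree of its `k × k` minors. -/
noncomputable def degMat {k n : ℕ} (G : Matrix (Fin k) (Fin n) (Polynomial F)) : ℕ :=
  Finset.univ.sup fun f : Fin k ↪ Fin n => (Matrix.det fun i i' => G i (f i')).natDegree

/-- A polynomial matrix is reduced if the sum of its row degrees equals its degree. -/
noncomputable def IsRowReduced {k n : ℕ} (G : Matrix (Fin k) (Fin n) (Polynomial F)) : Prop :=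
  (∑ i, rowDeg G i) = degMat G


theorem card_support_X_pow_mul {R : Type*} [Semiring R] (m : ℕ) (p : Polynomial R) :
    (X ^ m * p).support.card = p.support.card := by
  have h : (X ^ m * p).support = p.support.map (addRightEmbedding m) := by
    ext d
    simp only [mem_support_iff, Finset.mem_map, addRightEmbedding_apply, coeff_X_pow_mul']
    constructor
    · intro hd
      split_ifs at hd with hm
      · exact ⟨d - m, hd, Nat.sub_add_cancel hm⟩
      · exact absurd rfl hd
    · rintro ⟨e, he, rfl⟩
      simpa using he
  rw [h, Finset.card_map]

theorem card_support_C_mul {c : F} (hc : c ≠ 0) (p : Polynomial F) :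
    (C c * p).support.card = p.support.card := by
  congr 1
  ext d
  simp [hc]

/-- Polynomials that differ by a unit scalar and an integral power of the variable have the same
number of nonzero coefficients. -/
theorem card_support_eq_of_algebraMap_eq {p q : Polynomial F} (a : Fˣ) (m : ℤ)
    (h : algebraMap (Polynomial F) (RatFunc F) q = algebraMap (Polynomial F) (RatFunc F) p *
      (algebraMap F (RatFunc F) a * (RatFunc.X : RatFunc F) ^ m)) :
    p.support.card = q.support.card := by
  have hX : (RatFunc.X : RatFunc F) ≠ 0 := RatFunc.X_ne_zero
  have key : X ^ (-m).toNat * q = X ^ m.toNat * (C (a : F) * p) := by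
    apply RatFunc.algebraMap_injective F
    have hm : (RatFunc.X : RatFunc F) ^ m.toNat = RatFunc.X ^ (-m).toNat * RatFunc.X ^ m := by
      rw [← zpow_natCast, ← zpow_natCast, ← zpow_add₀ hX]
      congr 1
      omega
    simp only [map_mul, map_pow, RatFunc.algebraMap_X, RatFunc.algebraMap_C, h, hm,
      RatFunc.algebraMap_eq_C]
    ring
  rw [← card_support_X_pow_mul (-m).toNat q, key, card_support_X_pow_mul,
    card_support_C_mul a.ne_zero]

theorem coeff_prod_sum_of_natDegree_le {R ι : Type*} [CommSemiring R] (s : Finset ι)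
    (f : ι → Polynomial R) (d : ι → ℕ) (h : ∀ i ∈ s, (f i).natDegree ≤ d i) :
    (∏ i ∈ s, f i).coeff (∑ i ∈ s, d i) = ∏ i ∈ s, (f i).coeff (d i) := by
  classical
  induction s using Finset.induction_on with
  | empty => simp
  | insert a s ha ih =>
    have hs : ∀ i ∈ s, (f i).natDegree ≤ d i := fun i hi => h i (Finset.mem_insert_of_mem hi)
    rw [Finset.prod_insert ha, Finset.sum_insert ha, Finset.prod_insert ha,
      coeff_mul_add_eq_of_natDegree_le (h a (Finset.mem_insert_self a s))
        ((natDegree_prod_le _ _).trans (Finset.sum_le_sum hs)), ih hs]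

theorem coeff_det_sum_of_natDegree_le {R ι : Type*} [CommRing R] [Fintype ι] [DecidableEq ι]
    (A : Matrix ι ι (Polynomial R)) (d : ι → ℕ) (h : ∀ i j, (A i j).natDegree ≤ d i) :
    A.det.coeff (∑ i, d i) = (Matrix.of fun i j => (A i j).coeff (d i)).det := by
  rw [← det_transpose, ← det_transpose (Matrix.of _), det_apply', det_apply', finsetSum_coeff]
  refine Finset.sum_congr rfl fun σ _ => ?_
  rw [← C_eq_intCast, coeff_C_mul]
  congr 1
  exact coeff_prod_sum_of_natDegree_le _ _ _ fun i _ => h i (σ i)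

/-- The matrix of leading row coefficients. -/
def leadingRowCoeff {k n : ℕ} (G : Matrix (Fin k) (Fin n) (Polynomial F)) :
    Matrix (Fin k) (Fin n) F :=
  Matrix.of fun i j => (G i j).coeff (rowDeg G i)

theorem natDegree_le_rowDeg {k n : ℕ} (G : Matrix (Fin k) (Fin n) (Polynomial F))
    (i : Fin k) (j : Fin n) : (G i j).natDegree ≤ rowDeg G i :=
  Finset.le_sup (f := fun j => (G i j).natDegree) (Finset.mem_univ j)

theorem eq_zero_of_vecMul_eq_zero_of_rank_eq {K : Type*} [Field K] {k n : ℕ}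
    {A : Matrix (Fin k) (Fin n) K} (hA : A.rank = k) {c : Fin k → K} (hc : c ᵥ* A = 0) :
    c = 0 := by
  have hli : LinearIndependent K A.row := by
    rw [linearIndependent_iff_card_eq_finrank_span, Fintype.card_fin]
    exact hA.symm.trans A.rank_eq_finrank_span_row
  exact vecMul_injective_iff.mpr hli (hc.trans (zero_vecMul A).symm)

/-- The leading row coefficient matrix of a basic reduced matrix has independent rows. -/
theorem eq_zero_of_vecMul_leadingRowCoeff_eq_zero {k n : ℕ}
    {G : Matrix (Fin k) (Fin n) (Polynomial F)} (hG : IsBasic G) (hred : IsRowReduced G)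
    {c : Fin k → F} (hc : c ᵥ* leadingRowCoeff G = 0) : c = 0 := by
  by_cases hd : ∑ i, rowDeg G i = 0
  · have hdeg : ∀ i, rowDeg G i = 0 := fun i =>
      (Finset.sum_eq_zero_iff.mp hd) i (Finset.mem_univ i)
    have hmap : G.map (fun p => Polynomial.aeval (0 : AlgebraicClosure F) p)
        = (leadingRowCoeff G).map (algebraMap F (AlgebraicClosure F)) := by
      ext i j
      have hij : (G i j).natDegree = 0 := Nat.le_zero.mp (hdeg i ▸ natDegree_le_rowDeg G i j)
      rw [Matrix.map_apply, Matrix.map_apply, eq_C_of_natDegree_eq_zero hij]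
      simp [leadingRowCoeff, hdeg]
    have hz : (algebraMap F (AlgebraicClosure F) ∘ c) ᵥ*
        (leadingRowCoeff G).map (algebraMap F (AlgebraicClosure F)) = 0 := by
      ext j
      rw [← RingHom.map_vecMul, hc]
      simp
    have h0 := eq_zero_of_vecMul_eq_zero_of_rank_eq (hmap ▸ hG 0) hz
    ext i
    simpa using congrFun h0 i
  · have hpos : 0 < ∑ i, rowDeg G i := Nat.pos_of_ne_zero hd
    obtain ⟨f, -, hf⟩ := (Finset.le_sup_iff hpos).mp hred.le
    have hdet : (Matrix.det fun i i' => G i (f i')).coeff (∑ i, rowDeg G i) ≠ 0 := by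
      have hle : (Matrix.det fun i i' => G i (f i')).natDegree ≤ ∑ i, rowDeg G i :=
        hred.symm ▸ Finset.le_sup
          (f := fun f : Fin k ↪ Fin n => (Matrix.det fun i i' => G i (f i')).natDegree)
          (Finset.mem_univ f)
      rw [le_antisymm hf hle]
      refine leadingCoeff_ne_zero.mpr fun h0 => ?_
      rw [h0, natDegree_zero] at hf
      omega
    rw [coeff_det_sum_of_natDegree_le _ _ fun i j => natDegree_le_rowDeg G i (f j)] at hdet
    refine eq_zero_of_vecMul_eq_zero hdet ?_
    ext j
    exact congrFun hc (f j)

/-- The predictable degree property of basic reduced matrices. -/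
theorem degP_vecMul {k n : ℕ} {G : Matrix (Fin k) (Fin n) (Polynomial F)} (hG : IsBasic G)
    (hred : IsRowReduced G) [DecidableEq F] {u : Fin k → Polynomial F} (hu : u ≠ 0) :
    degP (u ᵥ* G) =
      (Finset.univ.filter fun i => u i ≠ 0).sup fun i => (u i).natDegree + rowDeg G i := by
  set s := Finset.univ.filter fun i => u i ≠ 0
  set D := s.sup fun i => (u i).natDegree + rowDeg G i
  have hD : ∀ i, u i ≠ 0 → (u i).natDegree + rowDeg G i ≤ D := fun i hi =>
    Finset.le_sup (f := fun i => (u i).natDegree + rowDeg G i) (by simp [s, hi])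
  apply le_antisymm
  · refine Finset.sup_le fun j _ => ?_
    change (∑ i, u i * G i j).natDegree ≤ D
    refine natDegree_sum_le_of_forall_le _ _ fun i _ => ?_
    by_cases hi : u i = 0
    · simp [hi]
    · exact natDegree_mul_le.trans
        ((Nat.add_le_add_left (natDegree_le_rowDeg G i j) _).trans (hD i hi))
  · let c : Fin k → F := fun i => (u i).coeff (D - rowDeg G i)
    have hc : c ≠ 0 := by
      obtain ⟨i₀, hi₀⟩ := Function.ne_iff.mp hu
      obtain ⟨i, hi, hmax⟩ := Finset.exists_mem_eq_sup s ⟨i₀, by simpa [s] using hi₀⟩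
        fun i => (u i).natDegree + rowDeg G i
      have hui : u i ≠ 0 := by simpa [s] using hi
      refine Function.ne_iff.mpr ⟨i, ?_⟩
      have : D - rowDeg G i = (u i).natDegree := by
        rw [show D = _ from hmax, Nat.add_sub_cancel]
      simp only [c, this]
      exact leadingCoeff_ne_zero.mpr hui
    have hcoeff : ∀ j, ((u ᵥ* G) j).coeff D = (c ᵥ* leadingRowCoeff G) j := by
      intro j
      simp only [vecMul, dotProduct, finsetSum_coeff]
      refine Finset.sum_congr rfl fun i _ => ?_
      by_cases hi : u i = 0
      · simp [hi, c]
      · have := hD i hi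
        have h := coeff_mul_add_eq_of_natDegree_le
          (show (u i).natDegree ≤ D - rowDeg G i by omega) (natDegree_le_rowDeg G i j)
        rwa [Nat.sub_add_cancel (by omega)] at h
    obtain ⟨j, hj⟩ := Function.ne_iff.mp
      (mt (eq_zero_of_vecMul_leadingRowCoeff_eq_zero hG hred) hc)
    rw [← hcoeff] at hj
    exact (le_natDegree_of_ne_zero hj).trans
      (Finset.le_sup (f := fun j => ((u ᵥ* G) j).natDegree) (Finset.mem_univ j))

/-- Multiplication by a `z`-monomial matrix preserves the weight. -/
theorem wtP_eq_of_isZMonomial {n : ℕ} {M : Matrix (Fin n) (Fin n) (RatFunc F)}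
    (hM : IsZMonomial M) {v w : Fin n → Polynomial F}
    (h : (fun j => algebraMap (Polynomial F) (RatFunc F) (w j)) =
      (fun j => algebraMap (Polynomial F) (RatFunc F) (v j)) ᵥ* M) : wtP v = wtP w := by
  obtain ⟨σ, α, μ, hM⟩ := hM
  unfold wtP
  rw [← Equiv.sum_comp σ fun j => (w j).support.card]
  refine Finset.sum_congr rfl fun i _ => card_support_eq_of_algebraMap_eq (α (σ i)) (μ (σ i)) ?_
  rw [show algebraMap (Polynomial F) (RatFunc F) (w (σ i)) = _ from congrFun h (σ i)]
  simp [vecMul, dotProduct, hM]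

/-- Two `z`-monomially equivalent basic reduced encoders with the same row degrees
are strongly isometric. -/
theorem stmt9 {F : Type*} [Field F] [Fintype F] {k n : ℕ}
    (G Gbar : Matrix (Fin k) (Fin n) (Polynomial F))
    (hG : IsBasic G) (hGred : IsRowReduced G)
    (hGbar : IsBasic Gbar) (hGbarred : IsRowReduced Gbar)
    (hzme : ∃ M : Matrix (Fin n) (Fin n) (RatFunc F), IsZMonomial M ∧
      Gbar.map (fun p => algebraMap (Polynomial F) (RatFunc F) p)
        = G.map (fun p => algebraMap (Polynomial F) (RatFunc F) p) * M)
    (hrow : ∀ i, rowDeg Gbar i = rowDeg G i) :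
    (∀ u : Fin k → Polynomial F, wtP (u ᵥ* G) = wtP (u ᵥ* Gbar)) ∧
    (∀ u : Fin k → Polynomial F, u ≠ 0 → degP (u ᵥ* G) = degP (u ᵥ* Gbar)) := by
  classical
  refine ⟨fun u => ?_, fun u hu => ?_⟩
  · obtain ⟨M, hM, h⟩ := hzme
    refine wtP_eq_of_isZMonomial hM ?_
    have hmap (A : Matrix (Fin k) (Fin n) (Polynomial F)) :
        (fun j => algebraMap (Polynomial F) (RatFunc F) ((u ᵥ* A) j)) =
          (algebraMap (Polynomial F) (RatFunc F) ∘ u) ᵥ*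
            A.map fun p => algebraMap (Polynomial F) (RatFunc F) p :=
      funext fun j => RingHom.map_vecMul _ A u j
    rw [hmap, hmap, h, vecMul_vecMul]
  · rw [degP_vecMul hG hGred hu, degP_vecMul hGbar hGbarred hu]
    simp only [hrow]
end
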